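/- Let h : ℝⁿ → (−∞, ∞] be proper, lower semicontinuous, convex, K_h-Lipschitz continuous on its compact domain H := dom h of diameter D_h, let f be differentiable on H with sup_{u∈H} ‖∇f(u)‖ =: G_f < ∞, let A : ℝⁿ → ℝˡ be a nonzero linear operator with smallest positive singular value σ_A⁺, and suppose z̄ ∈ int H satisfies Az̄ = b; set d̄ := dist_{∂H}(z̄). Let λ > 0, σ > 0, (χ, θ) ∈ (0,1)², p₀ in the range of A, and suppose sequences {z_k}_{k≥0} ⊂ H, {p_k}_{k≥1} ⊂ ℝˡ, {c_k}_{k≥1} ⊂ (0,∞), {v̂_k}_{k≥1} ⊂ ℝⁿ satisfy for every k ≥ 1: p_k = (1−θ)p_{k−1} + χ c_k (Az_k − b), the vector p̂_k := (1−θ)p_{k−1} + c_k(Az_k − b) lies in the range of A, ξ_k := v̂_k − ∇f(z_k) − A*p̂_k belongs to ∂h(z_k), and ‖v̂_k‖ ≤ (1+σ)‖z_k − z_{k−1}‖/λ. Then for every k ≥ 1, ‖p_k‖ ≤ B_p := max{‖p₀‖, β_λ} / min{1, d̄ σ_A⁺ (1−θ)}, where β_λ := (d̄ + D_h)[K_h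 + G_f + (1+σ)D_h/λ]. -/

import Mathlib

open RealInnerProductSpace
open scoped Classical

section

open Metric Set

/-- On the range of `A`, the adjoint is bounded below by any lower bound `s` on the positive
singular values of `A`. -/
theorem le_norm_adjoint_apply_of_lowerBound {E F : Type*} [NormedAddCommGroup E]
    [InnerProductSpace ℝ E] [FiniteDimensional ℝ E] [NormedAddCommGroup F]
    [InnerProductSpace ℝ F] [CompleteSpace F] (A : E →L[ℝ] F) {s : ℝ} (hs : 0 ≤ s)
    (hA : s ∈ lowerBounds {t : ℝ | 0 < t ∧ ∃ w : E, w ≠ 0 ∧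
      (ContinuousLinearMap.adjoint A) (A w) = (t ^ 2) • w}) (w : E) :
    s * ‖A w‖ ≤ ‖(ContinuousLinearMap.adjoint A) (A w)‖ := by
  set T : E →ₗ[ℝ] E := ((ContinuousLinearMap.adjoint A).comp A).toLinearMap
  have hpos : T.IsPositive :=
    (ContinuousLinearMap.isPositive_toLinearMap_iff _).2
      (ContinuousLinearMap.isPositive_adjoint_comp_self A)
  have hsymm := hpos.isSymmetric
  set e := hsymm.eigenvectorBasis rfl
  set μ := hsymm.eigenvalues rfl
  have hTe : ∀ i, ⟪e i, T w⟫ = μ i * ⟪e i, w⟫ := fun i => by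
    have := hsymm.eigenvectorBasis_apply_self_apply rfl w i
    rw [OrthonormalBasis.repr_apply_apply, OrthonormalBasis.repr_apply_apply] at this
    exact this
  have hμs : ∀ i, μ i = 0 ∨ s ^ 2 ≤ μ i := fun i => by
    rcases (hpos.nonneg_eigenvalues rfl i).eq_or_lt with h | h
    · exact Or.inl h.symm
    · right
      have hle : s ≤ √(μ i) := hA ⟨Real.sqrt_pos.2 h, e i, e.orthonormal.ne_zero i, by
        rw [Real.sq_sqrt h.le]
        exact hsymm.apply_eigenvectorBasis rfl i⟩
      calc s ^ 2 ≤ √(μ i) ^ 2 := by gcongr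
        _ = μ i := Real.sq_sqrt h.le
  have h₁ : ‖A w‖ ^ 2 = ∑ i, μ i * ⟪e i, w⟫ ^ 2 := by
    have h : ‖A w‖ ^ 2 = ⟪w, T w⟫ := by
      rw [← real_inner_self_eq_norm_sq, ← ContinuousLinearMap.adjoint_inner_right]
      rfl
    rw [h, ← e.sum_inner_mul_inner w (T w)]
    refine Finset.sum_congr rfl fun i _ => ?_
    rw [hTe, real_inner_comm]
    ring
  have h₂ : ‖T w‖ ^ 2 = ∑ i, μ i ^ 2 * ⟪e i, w⟫ ^ 2 := by
    rw [← e.sum_sq_norm_inner_right (T w)]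
    refine Finset.sum_congr rfl fun i _ => ?_
    rw [hTe, Real.norm_eq_abs, sq_abs, mul_pow]
  have h₃ : (s * ‖A w‖) ^ 2 ≤ ‖T w‖ ^ 2 := by
    rw [mul_pow, h₁, h₂, Finset.mul_sum]
    refine Finset.sum_le_sum fun i _ => ?_
    rcases hμs i with h | h
    · simp [h]
    · have : 0 ≤ μ i := (sq_nonneg s).trans h
      calc s ^ 2 * (μ i * ⟪e i, w⟫ ^ 2) ≤ μ i * (μ i * ⟪e i, w⟫ ^ 2) := by gcongr
        _ = _ := by ring
  exact le_of_sq_le_sq h₃ (norm_nonneg _)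

theorem infDist_frontier_pos_of_mem_interior {E : Type*} [NormedAddCommGroup E] [NormedSpace ℝ E]
    [Nontrivial E] {H : Set E} (hH : Bornology.IsBounded H) {x : E} (hx : x ∈ interior H) :
    0 < infDist x (frontier H) := by
  have hne : (frontier H).Nonempty := nonempty_frontier_iff.2
    ⟨⟨x, interior_subset hx⟩, fun h => NormedSpace.unbounded_univ ℝ E (h ▸ hH)⟩
  exact (isClosed_frontier.notMem_iff_infDist_pos hne).1 fun h => h.2 hx

theorem closedBall_infDist_frontier_subset {E : Type*} [NormedAddCommGroup E] [NormedSpace ℝ E]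
    {H : Set E} (hH : IsClosed H) {x : E} (hx : x ∈ interior H) :
    closedBall x (infDist x (frontier H)) ⊆ H := by
  rcases infDist_nonneg.eq_or_lt (a := (0 : ℝ)) (b := infDist x (frontier H)) with h | h
  · rw [← h, closedBall_zero]
    exact singleton_subset_iff.2 (interior_subset hx)
  · have hball : ball x (infDist x (frontier H)) ⊆ interior H := by
      refine (convex_ball x _).isPreconnected.subset_left_of_subset_union isOpen_interior
        hH.isOpen_compl (disjoint_compl_right.mono_left interior_subset) (fun y hy => ?_)
        ⟨x, mem_ball_self h, hx⟩
      by_contra hc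
      simp only [mem_union, mem_compl_iff, not_or, not_not] at hc
      have : y ∈ frontier H := ⟨subset_closure hc.2, hc.1⟩
      exact (infDist_le_dist_of_mem this).not_gt (mem_ball'.1 hy)
    rw [← closure_ball x h.ne']
    exact closure_minimal (hball.trans interior_subset) hH

/-- If `ξ` is a subgradient at `z` of a `K`-Lipschitz function on a set `H` of diameter at most `D`
containing the closed ball of radius `d` around `x`, then `d ‖ξ‖` is controlled by
`⟪ξ, z - x⟫`. -/
theorem mul_norm_subgradient_le {E : Type*} [NormedAddCommGroup E] [InnerProductSpace ℝ E]
    {H : Set E} {h : E → ℝ} {K D d : ℝ} (hK : 0 ≤ K)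
    (hlip : ∀ x ∈ H, ∀ y ∈ H, |h x - h y| ≤ K * ‖x - y‖) {x z ξ : E} (hd : 0 ≤ d)
    (hball : closedBall x d ⊆ H) (hz : z ∈ H) (hD : ‖z - x‖ ≤ D)
    (hξ : ∀ y ∈ H, h y ≥ h z + ⟪ξ, y - z⟫) :
    d * ‖ξ‖ ≤ (d + D) * K + ⟪ξ, z - x⟫ := by
  set u : E := (d * ‖ξ‖⁻¹) • ξ with hu
  have hun : ‖u‖ ≤ d := by
    rw [hu, norm_smul, Real.norm_of_nonneg (by positivity), mul_assoc]
    exact mul_le_of_le_one_right hd (inv_mul_le_one)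
  have hxu : x + u ∈ H := hball (by simpa [dist_eq_norm] using hun)
  have hin : ⟪ξ, x + u - z⟫ = d * ‖ξ‖ - ⟪ξ, z - x⟫ := by
    have h₁ : ⟪ξ, u⟫ = d * ‖ξ‖ := by
      rw [hu, inner_smul_right, real_inner_self_eq_norm_sq, sq, mul_assoc, ← mul_assoc ‖ξ‖⁻¹]
      rcases eq_or_ne ‖ξ‖ 0 with h | h
      · simp [h]
      · rw [inv_mul_cancel₀ h, one_mul]
    rw [show x + u - z = u - (z - x) by abel, inner_sub_right, h₁]
  have h₁ := hξ _ hxu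
  have h₂ := (le_abs_self _).trans (hlip _ hxu _ hz)
  have h₃ : ‖x + u - z‖ ≤ d + D := by
    rw [show x + u - z = u - (z - x) by abel]
    exact (norm_sub_le _ _).trans (add_le_add hun hD)
  nlinarith [mul_le_mul_of_nonneg_left h₃ hK]

/-- One step of the multiplier recursion: a bound `B` on the previous multiplier `p` carries over
to the undamped update `q = α p + c r`. -/
theorem norm_le_of_mul_norm_add_inner_le {F : Type*} [NormedAddCommGroup F]
    [InnerProductSpace ℝ F] {p q r : F} {c α δ β B : ℝ} (hc : 0 < c) (hα : 0 ≤ α) (hα1 : α ≤ 1)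
    (hq : q = α • p + c • r) (hB : ‖p‖ ≤ B) (hβ : β ≤ δ * B) (hδ : 0 < δ)
    (h : δ * ‖q‖ ≤ β - ⟪q, r⟫) : ‖q‖ ≤ B := by
  by_contra! hlt
  have hB0 : 0 ≤ B := (norm_nonneg p).trans hB
  have h₁ : c * ⟪q, r⟫ = ‖q‖ ^ 2 - α * ⟪q, p⟫ := by
    have : c • r = q - α • p := by rw [hq]; abel
    rw [← inner_smul_right, this, inner_sub_right, inner_smul_right, real_inner_self_eq_norm_sq]
  have h₂ : α * ⟪q, p⟫ ≤ ‖q‖ ^ 2 := by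
    calc α * ⟪q, p⟫ ≤ α * (‖q‖ * ‖p‖) := by gcongr; exact real_inner_le_norm q p
      _ ≤ 1 * (‖q‖ * ‖q‖) := by gcongr; exact hB.trans hlt.le
      _ = ‖q‖ ^ 2 := by ring
  have h₃ : 0 ≤ ⟪q, r⟫ := nonneg_of_mul_nonneg_right (by linarith : 0 ≤ c * ⟪q, r⟫) hc
  have h₄ : δ * B < δ * ‖q‖ := by gcongr
  linarith

end

/-- In the setting of Statement 14, let `(χ, θ) ∈ (0,1)²`, `p₀` in the range
of `A`, and suppose sequences `{z_k} ⊂ H`, `{p_k}`, `{c_k} ⊂ (0,∞)`, `{v̂_k}` satisfy, for every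
`k ≥ 1`: `p_k = (1−θ)p_{k−1} + χ c_k (Az_k − b)`, `p̂_k = (1−θ)p_{k−1} + c_k(Az_k − b)` lies in
the range of `A`, `ξ_k = v̂_k − ∇f(z_k) − A*p̂_k ∈ ∂h(z_k)`, and
`‖v̂_k‖ ≤ (1+σ)‖z_k − z_{k−1}‖/λ`.  Then for every `k ≥ 1`,
`‖p_k‖ ≤ max{‖p₀‖, β_λ} / min{1, d̄ σ_A⁺ (1−θ)}`, where
`β_λ = (d̄ + D_h)[K_h + G_f + (1+σ)D_h/λ]`. -/
theorem stmt_15 {n l : ℕ} (h : EuclideanSpace ℝ (Fin n) → ℝ)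
    (H : Set (EuclideanSpace ℝ (Fin n))) (hHne : H.Nonempty) (hHcpt : IsCompact H)
    (hhconv : ConvexOn ℝ H h)
    (hhlsc : LowerSemicontinuous fun x => if x ∈ H then ((h x : ℝ) : EReal) else (⊤ : EReal))
    (Kh : ℝ) (hKh : 0 ≤ Kh) (hhlip : ∀ x ∈ H, ∀ y ∈ H, |h x - h y| ≤ Kh * ‖x - y‖)
    (Dh : ℝ) (hDh : Dh = Metric.diam H)
    (f : EuclideanSpace ℝ (Fin n) → ℝ) (f' : EuclideanSpace ℝ (Fin n) → EuclideanSpace ℝ (Fin n))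
    (hf : ∀ u ∈ H, HasGradientWithinAt f (f' u) H u)
    (Gf : ℝ) (hGf : IsLUB ((fun u => ‖f' u‖) '' H) Gf)
    (A : EuclideanSpace ℝ (Fin n) →L[ℝ] EuclideanSpace ℝ (Fin l)) (hA : A ≠ 0)
    (σA : ℝ) (hσA : IsLeast {t : ℝ | 0 < t ∧ ∃ w : EuclideanSpace ℝ (Fin n), w ≠ 0 ∧
      (ContinuousLinearMap.adjoint A) (A w) = (t ^ 2) • w} σA)
    (b : EuclideanSpace ℝ (Fin l))
    (zbar : EuclideanSpace ℝ (Fin n)) (hzbar : zbar ∈ interior H) (hzbarb : A zbar = b)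
    (dbar : ℝ) (hdbar : dbar = Metric.infDist zbar (frontier H))
    (lam σ χ θ : ℝ) (hlam : 0 < lam) (hσ : 0 < σ)
    (hχ : χ ∈ Set.Ioo (0 : ℝ) 1) (hθ : θ ∈ Set.Ioo (0 : ℝ) 1)
    (z : ℕ → EuclideanSpace ℝ (Fin n)) (hz : ∀ k, z k ∈ H)
    (p : ℕ → EuclideanSpace ℝ (Fin l)) (hp₀ : p 0 ∈ Set.range A)
    (c : ℕ → ℝ) (hc : ∀ k, 0 < c k)
    (vhat : ℕ → EuclideanSpace ℝ (Fin n))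
    (hp : ∀ k, 1 ≤ k → p k = (1 - θ) • p (k - 1) + (χ * c k) • (A (z k) - b))
    (hphat : ∀ k, 1 ≤ k → (1 - θ) • p (k - 1) + (c k) • (A (z k) - b) ∈ Set.range A)
    (hξ : ∀ k, 1 ≤ k → ∀ z' ∈ H,
      h z' ≥ h (z k) + ⟪vhat k - f' (z k) -
        (ContinuousLinearMap.adjoint A) ((1 - θ) • p (k - 1) + (c k) • (A (z k) - b)),
        z' - z k⟫)
    (hvhat : ∀ k, 1 ≤ k → ‖vhat k‖ ≤ (1 + σ) * ‖z k - z (k - 1)‖ / lam) :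
    ∀ k, 1 ≤ k → ‖p k‖ ≤
      max ‖p 0‖ ((dbar + Dh) * (Kh + Gf + (1 + σ) * Dh / lam)) /
        min 1 (dbar * σA * (1 - θ)) := by
  have hα0 : 0 < 1 - θ := sub_pos.2 hθ.2
  have hα1 : 1 - θ < 1 := sub_lt_self _ hθ.1
  have hnt : Nontrivial (EuclideanSpace ℝ (Fin n)) := by
    obtain ⟨w, hw⟩ : ∃ w, A w ≠ 0 := by
      by_contra! hA0
      exact hA (ContinuousLinearMap.ext hA0)
    exact ⟨w, 0, fun h0 => hw (by rw [h0, map_zero])⟩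
  have hd : 0 < dbar := hdbar ▸ infDist_frontier_pos_of_mem_interior hHcpt.isBounded hzbar
  have hball : Metric.closedBall zbar dbar ⊆ H :=
    hdbar ▸ closedBall_infDist_frontier_subset hHcpt.isClosed hzbar
  have hdiam : ∀ x ∈ H, ∀ y ∈ H, ‖x - y‖ ≤ Dh := fun x hx y hy => by
    rw [hDh, ← dist_eq_norm]
    exact Metric.dist_le_diam_of_mem hHcpt.isBounded hx hy
  have hDh0 : 0 ≤ Dh := hDh ▸ Metric.diam_nonneg
  have hσA0 : 0 < σA := hσA.1.1
  set β := (dbar + Dh) * (Kh + Gf + (1 + σ) * Dh / lam) with hβ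
  set m := min 1 (dbar * σA * (1 - θ))
  have hδ : 0 < dbar * σA := by positivity
  have hm0 : 0 < m := lt_min one_pos (by positivity)
  set B := max ‖p 0‖ β / m
  have hBm : B * m = max ‖p 0‖ β := div_mul_cancel₀ _ hm0.ne'
  have hB0 : 0 ≤ B := div_nonneg ((norm_nonneg _).trans (le_max_left _ _)) hm0.le
  have hp0B : ‖p 0‖ ≤ B := by
    have := mul_le_of_le_one_right hB0 (min_le_left 1 (dbar * σA * (1 - θ)))
    exact (le_max_left _ β).trans (hBm ▸ this)
  have hβB : β ≤ dbar * σA * B := by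
    calc β ≤ B * m := hBm ▸ le_max_right _ _
      _ ≤ B * (dbar * σA * (1 - θ)) := by gcongr; exact min_le_right _ _
      _ ≤ B * (dbar * σA * 1) := by gcongr
      _ = dbar * σA * B := by ring
  suffices hall : ∀ k, ‖p k‖ ≤ B from fun k _ => hall k
  intro k
  induction k with
  | zero => exact hp0B
  | succ k ih =>
    have hk : 1 ≤ k + 1 := Nat.le_add_left 1 k
    have hpk := hp _ hk
    have hqr := hphat _ hk
    have hsub := hξ _ hk
    have hvk := hvhat _ hk
    rw [Nat.add_sub_cancel] at hpk hqr hsub hvk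
    set q := (1 - θ) • p k + c (k + 1) • (A (z (k + 1)) - b) with hq
    set g := vhat (k + 1) - f' (z (k + 1))
    have hgn : ‖g‖ ≤ Gf + (1 + σ) * Dh / lam := by
      have h₁ : ‖f' (z (k + 1))‖ ≤ Gf := hGf.1 ⟨_, hz _, rfl⟩
      have h₂ : ‖vhat (k + 1)‖ ≤ (1 + σ) * Dh / lam := hvk.trans (by
        gcongr
        exact hdiam _ (hz _) _ (hz _))
      linarith [norm_sub_le (vhat (k + 1)) (f' (z (k + 1)))]
    have hzz := hdiam _ (hz (k + 1)) _ (interior_subset hzbar)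
    have hsg := mul_norm_subgradient_le hKh hhlip hd.le hball (hz _) hzz hsub
    have hin : ⟪g - (ContinuousLinearMap.adjoint A) q, z (k + 1) - zbar⟫ =
        ⟪g, z (k + 1) - zbar⟫ - ⟪q, A (z (k + 1)) - b⟫ := by
      rw [inner_sub_left, ContinuousLinearMap.adjoint_inner_left, map_sub, hzbarb]
    have hgz : ⟪g, z (k + 1) - zbar⟫ ≤ (Gf + (1 + σ) * Dh / lam) * Dh :=
      (real_inner_le_norm _ _).trans (by gcongr; exact (norm_nonneg _).trans hgn)
    have hadj : σA * ‖q‖ ≤ ‖(ContinuousLinearMap.adjoint A) q‖ := by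
      obtain ⟨w, hw⟩ := hqr
      rw [← hw]
      exact le_norm_adjoint_apply_of_lowerBound A hσA0.le hσA.2 w
    have htri : ‖(ContinuousLinearMap.adjoint A) q‖ ≤
        (Gf + (1 + σ) * Dh / lam) + ‖g - (ContinuousLinearMap.adjoint A) q‖ := by
      have := norm_sub_le g (g - (ContinuousLinearMap.adjoint A) q)
      rw [sub_sub_cancel] at this
      linarith
    have hkey : dbar * σA * ‖q‖ ≤ β - ⟪q, A (z (k + 1)) - b⟫ := by
      have h₁ := mul_le_mul_of_nonneg_left (hadj.trans htri) hd.le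
      rw [hin] at hsg
      rw [hβ]
      linarith
    have hqB : ‖q‖ ≤ B :=
      norm_le_of_mul_norm_add_inner_le (hc _) hα0.le hα1.le hq ih hβB hδ hkey
    have hconv : p (k + 1) = ((1 - χ) * (1 - θ)) • p k + χ • q := by
      rw [hpk, hq]
      module
    have hχ1 : 0 ≤ 1 - χ := sub_nonneg.2 hχ.2.le
    calc ‖p (k + 1)‖ ≤ ((1 - χ) * (1 - θ)) * ‖p k‖ + χ * ‖q‖ := by
          rw [hconv]
          refine (norm_add_le _ _).trans_eq ?_
          rw [norm_smul, norm_smul, Real.norm_of_nonneg (by positivity),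
            Real.norm_of_nonneg hχ.1.le]
      _ ≤ ((1 - χ) * 1) * B + χ * B := by
          have := hχ.1.le
          gcongr
      _ = B := by ring
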